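/- Let d ≥ 1, let τ be in the upper half-plane, let z ∈ ℂ, and let x_1, …, x_d ∈ ℂ satisfy θ(x_i/(2πi), τ) ≠ 0 for all i. Define E(z, τ, x_1, …, x_d) = ∏_{i=1}^{d} x_i · θ(x_i/(2πi) - z, τ) / θ(x_i/(2πi), τ). Then E(z/τ, -1/τ, x_1/τ, …, x_d/τ) = τ^{-d} · e^{πi d z²/τ} · e^{-(z/τ) ∑_{i=1}^{d} x_i} · E(z, τ, x_1, …, x_d). -/

import Mathlib

open Complex

/-- The Jacobi theta function `θ_{1,1}`, defined for `τ` in the upper half-plane and `z ∈ ℂ`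
by the product `θ(z,τ) = q^{1/8} (2 sin πz) ∏_{l ≥ 1} (1-q^l) ∏_{l ≥ 1} (1-q^l e^{2πiz})(1-q^l e^{-2πiz})`
with `q = e^{2πiτ}` (so `q^{1/8} = e^{πiτ/4}`). -/
noncomputable def jTheta (z τ : ℂ) : ℂ :=
  Complex.exp ((Real.pi : ℂ) * I * τ / 4) * (2 * Complex.sin ((Real.pi : ℂ) * z)) *
    (∏' l : ℕ, (1 - Complex.exp (2 * (Real.pi : ℂ) * I * τ) ^ (l + 1))) *
    ∏' l : ℕ,
      ((1 - Complex.exp (2 * (Real.pi : ℂ) * I * τ) ^ (l + 1) *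
          Complex.exp (2 * (Real.pi : ℂ) * I * z)) *
       (1 - Complex.exp (2 * (Real.pi : ℂ) * I * τ) ^ (l + 1) *
          Complex.exp (-(2 * (Real.pi : ℂ) * I) * z)))

/-- The generating function `E(z, τ, x₁, …, x_d) = ∏ᵢ xᵢ θ(xᵢ/(2πi) - z, τ) / θ(xᵢ/(2πi), τ)`
whose degree-`d` term computes the elliptic genus of a `d`-dimensional complex manifold with
Chern roots `xᵢ`. -/
noncomputable def Efun (d : ℕ) (z τ : ℂ) (x : Fin d → ℂ) : ℂ :=
  ∏ i, x i * jTheta (x i / (2 * (Real.pi : ℂ) * I) - z) τ /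
    jTheta (x i / (2 * (Real.pi : ℂ) * I)) τ

noncomputable def jP (q w : ℂ) : ℂ := ∏' l : ℕ, (1 + -(q ^ l * w))

lemma jP_summable {q : ℂ} (hq : ‖q‖ < 1) (w : ℂ) : Summable fun l : ℕ => ‖-(q ^ l * w)‖ := by
  simpa using (summable_geometric_of_lt_one (norm_nonneg q) hq).mul_right ‖w‖

lemma jP_multipliable {q : ℂ} (hq : ‖q‖ < 1) (w : ℂ) :
    Multipliable fun l : ℕ => (1 + -(q ^ l * w)) :=
  multipliable_one_add_of_summable (jP_summable hq w)

lemma jP_rec {q : ℂ} (hq : ‖q‖ < 1) (w : ℂ) : jP q w = (1 - w) * jP q (q * w) := by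
  unfold jP
  rw [tprod_eq_zero_mul']
  · simp only [pow_zero, one_mul, ← sub_eq_add_neg, pow_succ, mul_assoc]
  · refine (jP_multipliable hq (q * w)).congr fun l => ?_
    ring

lemma jP_ne_zero {q : ℂ} (hq : ‖q‖ < 1) {w : ℂ} (h : ∀ l : ℕ, q ^ l * w ≠ 1) : jP q w ≠ 0 := by
  refine tprod_one_add_ne_zero_of_summable (fun l => ?_) (jP_summable hq w)
  rw [← sub_eq_add_neg, sub_ne_zero]
  exact (h l).symm

lemma jP_differentiable {q : ℂ} (hq : ‖q‖ < 1) : Differentiable ℂ (jP q) := by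
  intro w
  have hs : Summable fun l : ℕ => ‖q‖ ^ l * (‖w‖ + 1) :=
    (summable_geometric_of_lt_one (norm_nonneg q) hq).mul_right _
  have H := Summable.hasProdLocallyUniformlyOn_nat_one_add (R := ℂ) (f := fun (l : ℕ) (w : ℂ) => -(q ^ l * w))
    (Metric.isOpen_ball (x := (0 : ℂ)) (ε := ‖w‖ + 1)) hs
    (.of_forall fun n x hx => by
      have : ‖x‖ < ‖w‖ + 1 := by simpa using hx
      simp only [norm_neg, norm_mul, norm_pow]
      gcongr) (fun n => by fun_prop)
  have := H.differentiableOn (.of_forall fun s => by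
      simpa [Finset.prod_fn] using
      DifferentiableOn.finsetProd (fun _ _ ↦ by fun_prop)) Metric.isOpen_ball
  exact this.differentiableAt (Metric.isOpen_ball.mem_nhds (by simp))

lemma jq_norm {τ : ℂ} (hτ : 0 < τ.im) : ‖Complex.exp (2 * (Real.pi : ℂ) * I * τ)‖ < 1 := by
  simpa using UpperHalfPlane.norm_exp_two_pi_I_lt_one ⟨τ, hτ⟩

lemma jTheta_eq {τ : ℂ} (hτ : 0 < τ.im) (z : ℂ) :
    jTheta z τ = Complex.exp ((Real.pi : ℂ) * I * τ / 4) * (2 * Complex.sin ((Real.pi : ℂ) * z)) *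
      jP (Complex.exp (2 * (Real.pi : ℂ) * I * τ)) (Complex.exp (2 * (Real.pi : ℂ) * I * τ)) *
      (jP (Complex.exp (2 * (Real.pi : ℂ) * I * τ))
        (Complex.exp (2 * (Real.pi : ℂ) * I * τ) * Complex.exp (2 * (Real.pi : ℂ) * I * z)) *
       jP (Complex.exp (2 * (Real.pi : ℂ) * I * τ))
        (Complex.exp (2 * (Real.pi : ℂ) * I * τ) * Complex.exp (-(2 * (Real.pi : ℂ) * I) * z))) := by
  have hq := jq_norm hτ
  unfold jTheta
  generalize Complex.exp (2 * (Real.pi : ℂ) * I * τ) = q at *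
  unfold jP
  rw [← (jP_multipliable hq _).tprod_mul (jP_multipliable hq _)]
  simp only [← sub_eq_add_neg, pow_succ, mul_assoc]

lemma two_sin_eq (z : ℂ) : 2 * Complex.sin ((Real.pi : ℂ) * z) =
    I * Complex.exp (-(Real.pi * I * z)) * (1 - Complex.exp (2 * (Real.pi : ℂ) * I * z)) := by
  rw [Complex.two_sin, mul_sub, mul_one, mul_assoc I, ← Complex.exp_add]
  ring_nf

lemma jTheta_eq' {τ : ℂ} (hτ : 0 < τ.im) (z : ℂ) :
    jTheta z τ = (Complex.exp ((Real.pi : ℂ) * I * τ / 4) * I *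
      jP (Complex.exp (2 * (Real.pi : ℂ) * I * τ)) (Complex.exp (2 * (Real.pi : ℂ) * I * τ))) *
      Complex.exp (-(Real.pi * I * z)) *
      (jP (Complex.exp (2 * (Real.pi : ℂ) * I * τ)) (Complex.exp (2 * (Real.pi : ℂ) * I * z)) *
       jP (Complex.exp (2 * (Real.pi : ℂ) * I * τ))
        (Complex.exp (2 * (Real.pi : ℂ) * I * τ) * Complex.exp (-(2 * (Real.pi : ℂ) * I) * z))) := by
  rw [jTheta_eq hτ, two_sin_eq,
    jP_rec (jq_norm hτ) (Complex.exp (2 * (Real.pi : ℂ) * I * z))]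
  ring

lemma jP_self_ne_zero {q : ℂ} (hq : ‖q‖ < 1) : jP q q ≠ 0 := by
  refine jP_ne_zero hq fun l h => ?_
  rw [← pow_succ] at h
  have := pow_lt_one₀ (norm_nonneg q) hq (Nat.succ_ne_zero l)
  rw [← norm_pow, h] at this
  simp at this

lemma jTheta_differentiable {τ : ℂ} (hτ : 0 < τ.im) : Differentiable ℂ fun z => jTheta z τ := by
  simp only [jTheta_eq hτ]
  have h := jP_differentiable (jq_norm hτ)
  fun_prop

lemma jTheta_deriv_ne_zero {τ : ℂ} (hτ : 0 < τ.im) : deriv (fun z => jTheta z τ) 0 ≠ 0 := by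
  have hq := jq_norm hτ
  have h := jP_differentiable hq
  have h0 := jP_self_ne_zero hq
  have hfun : (fun z => jTheta z τ) = fun z => Complex.sin ((Real.pi : ℂ) * z) *
      (Complex.exp ((Real.pi : ℂ) * I * τ / 4) * 2 *
      jP (Complex.exp (2 * (Real.pi : ℂ) * I * τ)) (Complex.exp (2 * (Real.pi : ℂ) * I * τ)) *
      (jP (Complex.exp (2 * (Real.pi : ℂ) * I * τ))
        (Complex.exp (2 * (Real.pi : ℂ) * I * τ) * Complex.exp (2 * (Real.pi : ℂ) * I * z)) *
       jP (Complex.exp (2 * (Real.pi : ℂ) * I * τ))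
        (Complex.exp (2 * (Real.pi : ℂ) * I * τ) * Complex.exp (-(2 * (Real.pi : ℂ) * I) * z)))) := by
    funext z
    rw [jTheta_eq hτ]
    ring
  rw [hfun, deriv_fun_mul (by fun_prop) (by fun_prop)]
  have hs : deriv (fun z : ℂ => Complex.sin ((Real.pi : ℂ) * z)) 0 = Real.pi := by
    have := ((hasDerivAt_id (0 : ℂ)).const_mul (Real.pi : ℂ)).csin
    simpa using this.deriv
  rw [hs]
  simp [h0, Real.pi_ne_zero]

lemma jTheta_zero (τ : ℂ) : jTheta 0 τ = 0 := by simp [jTheta]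

lemma jTheta_add_one {τ : ℂ} (hτ : 0 < τ.im) (z : ℂ) : jTheta (z + 1) τ = -jTheta z τ := by
  have e1 : Complex.exp (2 * (Real.pi : ℂ) * I * (z + 1)) =
      Complex.exp (2 * (Real.pi : ℂ) * I * z) := by
    rw [mul_add, Complex.exp_add, mul_one, Complex.exp_two_pi_mul_I, mul_one]
  have e2 : Complex.exp (-(2 * (Real.pi : ℂ) * I) * (z + 1)) =
      Complex.exp (-(2 * (Real.pi : ℂ) * I) * z) := by
    rw [mul_add, Complex.exp_add, mul_one, Complex.exp_neg (2 * (Real.pi : ℂ) * I),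
      Complex.exp_two_pi_mul_I, inv_one, mul_one]
  have e3 : Complex.sin ((Real.pi : ℂ) * (z + 1)) = - Complex.sin ((Real.pi : ℂ) * z) := by
    rw [mul_add, mul_one, Complex.sin_add_pi]
  rw [jTheta_eq hτ, jTheta_eq hτ, e1, e2, e3]
  ring

lemma jTheta_add_tau {τ : ℂ} (hτ : 0 < τ.im) (z : ℂ) :
    jTheta (z + τ) τ = -Complex.exp (-(Real.pi * I * τ) - 2 * Real.pi * I * z) * jTheta z τ := by
  have hq := jq_norm hτ
  rw [jTheta_eq' hτ, jTheta_eq' hτ]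
  have e1 : Complex.exp (2 * (Real.pi : ℂ) * I * (z + τ)) =
      Complex.exp (2 * (Real.pi : ℂ) * I * τ) * Complex.exp (2 * (Real.pi : ℂ) * I * z) := by
    rw [← Complex.exp_add]; ring_nf
  have e2 : Complex.exp (2 * (Real.pi : ℂ) * I * τ) *
      Complex.exp (-(2 * (Real.pi : ℂ) * I) * (z + τ)) =
      Complex.exp (-(2 * (Real.pi : ℂ) * I) * z) := by
    rw [← Complex.exp_add]; ring_nf
  have e3 : Complex.exp (-(Real.pi * I * (z + τ))) =
      Complex.exp (-(Real.pi * I * τ)) * Complex.exp (-(Real.pi * I * z)) := by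
    rw [← Complex.exp_add]; ring_nf
  have e4 : Complex.exp (-(Real.pi * I * τ) - 2 * Real.pi * I * z) =
      Complex.exp (-(Real.pi * I * τ)) * Complex.exp (-(2 * (Real.pi : ℂ) * I) * z) := by
    rw [← Complex.exp_add]; ring_nf
  have e5 : Complex.exp (-(2 * (Real.pi : ℂ) * I) * z) * Complex.exp (2 * (Real.pi : ℂ) * I * z)
      = 1 := by
    rw [← Complex.exp_add]; simp
  rw [e2, e1, e3, e4, jP_rec hq (Complex.exp (-(2 * (Real.pi : ℂ) * I) * z)),
    jP_rec hq (Complex.exp (2 * (Real.pi : ℂ) * I * z))]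
  generalize jP _ (_ * Complex.exp (-(2 * (Real.pi : ℂ) * I) * z)) = A
  generalize jP _ (_ * Complex.exp (2 * (Real.pi : ℂ) * I * z)) = B
  generalize jP _ _ = C
  linear_combination (-Complex.exp ((Real.pi : ℂ) * I * τ / 4) * I * C *
    Complex.exp (-(Real.pi * I * τ)) * Complex.exp (-(Real.pi * I * z)) * A * B) * e5

lemma jTheta_zero_lattice {τ : ℂ} (hτ : 0 < τ.im) {z : ℂ} (h : jTheta z τ = 0) :
    ∃ m n : ℤ, z = m + n * τ := by
  have hq := jq_norm hτ
  rw [jTheta_eq' hτ] at h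
  have h0 := jP_self_ne_zero hq
  have hpi : (2 * (Real.pi : ℂ) * I) ≠ 0 := Complex.two_pi_I_ne_zero
  simp only [mul_eq_zero, Complex.exp_ne_zero, I_ne_zero, h0, or_self, false_or] at h
  rcases h with h | h
  · have : ∃ l : ℕ, Complex.exp (2 * (Real.pi : ℂ) * I * τ) ^ l *
        Complex.exp (2 * (Real.pi : ℂ) * I * z) = 1 := by
      by_contra! hc
      exact jP_ne_zero hq hc h
    obtain ⟨l, hl⟩ := this
    rw [← Complex.exp_nat_mul, ← Complex.exp_add, Complex.exp_eq_one_iff] at hl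
    obtain ⟨n, hn⟩ := hl
    refine ⟨n, -l, mul_left_cancel₀ hpi ?_⟩
    push_cast
    linear_combination hn
  · have : ∃ l : ℕ, Complex.exp (2 * (Real.pi : ℂ) * I * τ) ^ l *
        (Complex.exp (2 * (Real.pi : ℂ) * I * τ) * Complex.exp (-(2 * (Real.pi : ℂ) * I) * z)) = 1 := by
      by_contra! hc
      exact jP_ne_zero hq hc h
    obtain ⟨l, hl⟩ := this
    rw [← Complex.exp_nat_mul, ← Complex.exp_add, ← Complex.exp_add, Complex.exp_eq_one_iff] at hl
    obtain ⟨n, hn⟩ := hl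
    refine ⟨-n, l + 1, mul_left_cancel₀ hpi ?_⟩
    push_cast
    linear_combination -hn

lemma lattice_invariant {P : ℂ → Prop} {τ : ℂ} (h1 : ∀ z, P (z + 1) ↔ P z)
    (h2 : ∀ z, P (z + τ) ↔ P z) (m n : ℤ) (z : ℂ) : P (z + (m + n * τ)) ↔ P z := by
  have key : ∀ (c : ℂ), (∀ z, P (z + c) ↔ P z) → ∀ (m : ℤ) (z : ℂ), P (z + m * c) ↔ P z := by
    intro c hc m
    induction m using Int.induction_on with
    | zero => simp
    | succ i ih =>
      intro z
      rw [← ih z, ← hc (z + ((i : ℤ) : ℂ) * c)]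
      push_cast
      ring_nf
    | pred i ih =>
      intro z
      rw [← ih z, ← hc (z + ((-(i : ℤ) - 1 : ℤ) : ℂ) * c)]
      push_cast
      ring_nf
  rw [← add_assoc, key τ h2, ← mul_one (m : ℂ), key 1 h1]

/-- Liouville argument: two quasi-periodic functions with the same multipliers. -/
lemma theta_unique {τ : ℂ} (hτ : 0 < τ.im) (F : ℂ → ℂ) (hF : Differentiable ℂ F) (hF0 : F 0 = 0)
    (hF1 : ∀ z, F (z + 1) = -F z)
    (hF2 : ∀ z, F (z + τ) = -Complex.exp (-(Real.pi * I * τ) - 2 * Real.pi * I * z) * F z) :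
    ∃ C : ℂ, ∀ z, F z = C * jTheta z τ := by
  classical
  set θ : ℂ → ℂ := fun z => jTheta z τ with hθ
  have hd : Differentiable ℂ θ := jTheta_differentiable hτ
  have hθ0 : θ 0 = 0 := jTheta_zero τ
  have hθ1 : ∀ z, θ (z + 1) = -θ z := jTheta_add_one hτ
  have hθ2 : ∀ z, θ (z + τ) = -Complex.exp (-(Real.pi * I * τ) - 2 * Real.pi * I * z) * θ z :=
    jTheta_add_tau hτ
  have hdz : deriv θ 0 ≠ 0 := jTheta_deriv_ne_zero hτ
  have hlat : ∀ z, θ z = 0 → ∃ m n : ℤ, z = m + n * τ := fun z => jTheta_zero_lattice hτ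
  clear_value θ
  set H := dslope θ 0
  set K := dslope F 0
  have hH : Differentiable ℂ H := by
    rw [← differentiableOn_univ] at hd ⊢
    exact (Complex.differentiableOn_dslope Filter.univ_mem).2 hd
  have hK : Differentiable ℂ K := by
    rw [← differentiableOn_univ] at hF ⊢
    exact (Complex.differentiableOn_dslope Filter.univ_mem).2 hF
  have hH0 : H 0 ≠ 0 := by simpa [H] using hdz
  have hHe : ∀ z, θ z = z * H z := by
    intro z
    have := sub_smul_dslope θ 0 z
    simpa [hθ0] using this.symm
  have hKe : ∀ z, F z = z * K z := by
    intro z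
    have := sub_smul_dslope F 0 z
    simpa [hF0] using this.symm
  set g : ℂ → ℂ := fun z => if θ z = 0 then K 0 / H 0 else F z / θ z with hg
  have hg1 : ∀ z, g (z + 1) = g z := by
    intro z
    simp only [hg, hθ1, hF1, neg_eq_zero, neg_div_neg_eq]
  have hg2 : ∀ z, g (z + τ) = g z := by
    intro z
    have he := Complex.exp_ne_zero (-(Real.pi * I * τ) - 2 * Real.pi * I * z)
    simp only [hg, hθ2, hF2, mul_eq_zero, neg_eq_zero, he, false_or]
    rw [mul_div_mul_left _ _ (neg_ne_zero.2 he)]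
  have hgd0 : DifferentiableAt ℂ g 0 := by
    have hq : DifferentiableAt ℂ (fun z => K z / H z) 0 := (hK 0).div (hH 0) hH0
    refine hq.congr_of_eventuallyEq ?_
    filter_upwards [hH.continuous.continuousAt.eventually_ne hH0] with z hz
    by_cases h0 : z = 0
    · simp [hg, h0, hθ0]
    · simp only [hg, hHe, hKe, mul_eq_zero, h0, hz, or_self, if_false]
      rw [mul_div_mul_left _ _ h0]
  have hgd : Differentiable ℂ g := by
    intro z
    by_cases hz : θ z = 0
    · obtain ⟨m, n, rfl⟩ := hlat z hz
      have hsh : ∀ c, (∀ z, g (z + c) = g z) → ∀ z,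
          DifferentiableAt ℂ g (z + c) ↔ DifferentiableAt ℂ g z := by
        intro c hc z
        rw [← differentiableAt_comp_add_const]
        simp only [hc]
      have := lattice_invariant (P := fun z => DifferentiableAt ℂ g z) (hsh 1 hg1) (hsh τ hg2) m n 0
      simp only [zero_add] at this
      exact this.2 hgd0
    · have hq : DifferentiableAt ℂ (fun z => F z / θ z) z := (hF z).div (hd z) hz
      refine hq.congr_of_eventuallyEq ?_
      filter_upwards [hd.continuous.continuousAt.eventually_ne hz] with w hw
      simp [hg, hw]
  have hb : Bornology.IsBounded (Set.range g) := by
    have hc : IsCompact ((fun p : ℝ × ℝ => g ((p.1 : ℂ) + p.2 * τ)) ''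
        (Set.Icc (0 : ℝ) 1 ×ˢ Set.Icc (0 : ℝ) 1)) := by
      refine (isCompact_Icc.prod isCompact_Icc).image ?_
      have := hgd.continuous
      fun_prop
    refine hc.isBounded.subset ?_
    rintro _ ⟨z, rfl⟩
    set b := z.im / τ.im
    set a := z.re - b * τ.re
    have hz : z = a + b * τ := by
      apply Complex.ext
      · simp [a]
      · simp [b, hτ.ne']
    refine ⟨(Int.fract a, Int.fract b), ⟨⟨Int.fract_nonneg _, (Int.fract_lt_one _).le⟩,
      ⟨Int.fract_nonneg _, (Int.fract_lt_one _).le⟩⟩, ?_⟩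
    have := lattice_invariant (P := fun w => g w = g z) (fun w => by rw [hg1]) (fun w => by rw [hg2])
      (-⌊a⌋) (-⌊b⌋) z
    have h3 := this.2 rfl
    simp only
    rw [← h3]
    congr 1
    rw [← Int.self_sub_floor, ← Int.self_sub_floor]
    push_cast
    linear_combination -hz
  refine ⟨g 0, ?_⟩
  have hconst : ∀ z, g z = g 0 := fun z => hgd.apply_eq_apply_of_bounded hb z 0
  intro z
  by_cases hz : θ z = 0
  · obtain ⟨m, n, rfl⟩ := hlat z hz
    have := lattice_invariant (P := fun z => F z = 0) (τ := τ) (by simp [hF1])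
      (by simp [hF2]) m n 0
    simp only [zero_add] at this
    rw [this.2 hF0]
    rw [hθ] at hz
    simp only at hz
    rw [hz, mul_zero]
  · have := hconst z
    rw [← this]
    simp only [hg, hz, if_false]
    rw [← show θ z = jTheta z τ by rw [hθ]]
    field_simp

lemma jTheta_modular {τ : ℂ} (hτ : 0 < τ.im) : ∃ C : ℂ, C ≠ 0 ∧ ∀ z,
    jTheta (z / τ) (-1 / τ) = C * Complex.exp (Real.pi * I * z ^ 2 / τ) * jTheta z τ := by
  have hτ0 : τ ≠ 0 := by rintro rfl; simp at hτ
  have hτ' : 0 < (-1 / τ).im := by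
    have := UpperHalfPlane.im_pnat_div_pos 1 ⟨τ, hτ⟩
    simpa using this
  obtain ⟨C, hC⟩ := theta_unique hτ
    (fun z => Complex.exp (-(Real.pi * I * z ^ 2 / τ)) * jTheta (z / τ) (-1 / τ))
    (by
      have h : Differentiable ℂ fun z => jTheta (z / τ) (-1 / τ) :=
        (jTheta_differentiable hτ').comp (by fun_prop : Differentiable ℂ fun z : ℂ => z / τ)
      fun_prop)
    (by simp [jTheta_zero])
    (by
      intro z
      have h := jTheta_add_tau hτ' ((z + 1) / τ)
      have e : (z + 1) / τ + -1 / τ = z / τ := by ring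
      rw [e] at h
      rw [h, neg_mul, mul_neg, neg_neg, ← mul_assoc, ← Complex.exp_add]
      congr 2
      field_simp
      ring)
    (by
      intro z
      have e : (z + τ) / τ = z / τ + 1 := by field_simp
      rw [e, jTheta_add_one hτ', neg_mul, mul_neg, ← mul_assoc, ← Complex.exp_add]
      congr 3
      field_simp
      ring)
  have hmain : ∀ z, jTheta (z / τ) (-1 / τ) =
      C * Complex.exp (Real.pi * I * z ^ 2 / τ) * jTheta z τ := by
    intro z
    have := hC z
    simp only [Complex.exp_neg] at this
    have he := Complex.exp_ne_zero (Real.pi * I * z ^ 2 / τ)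
    rw [inv_mul_eq_iff_eq_mul₀ he] at this
    rw [this]
    ring
  refine ⟨C, ?_, hmain⟩
  rintro rfl
  apply jTheta_deriv_ne_zero hτ'
  have : (fun z => jTheta z (-1 / τ)) = fun _ => 0 := by
    funext z
    have := hmain (z * τ)
    rw [mul_div_cancel_right₀ _ hτ0] at this
    simpa using this
  rw [this]
  simp


/-- Identity (9) in the proof of Theorem 3.2 of the paper (the modular transformation law of
the elliptic genus):
`E(z/τ, -1/τ, x₁/τ, …, x_d/τ) = τ^{-d} e^{πidz²/τ} e^{-(z/τ)∑ᵢxᵢ} E(z, τ, x₁, …, x_d)`. -/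
theorem E_modular_transformation (d : ℕ) (hd : 1 ≤ d) (τ z : ℂ) (hτ : 0 < τ.im)
    (x : Fin d → ℂ)
    (hθ : ∀ i, jTheta (x i / (2 * (Real.pi : ℂ) * I)) τ ≠ 0) :
    Efun d (z / τ) (-1 / τ) (fun i => x i / τ) =
      (τ ^ d)⁻¹ * Complex.exp ((Real.pi : ℂ) * I * d * z ^ 2 / τ) *
        Complex.exp (-(z / τ) * ∑ i, x i) * Efun d z τ x := by
  obtain ⟨C, hC, hmod⟩ := jTheta_modular hτ
  have hτ0 : τ ≠ 0 := by rintro rfl; simp at hτ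
  have hpi : (2 * (Real.pi : ℂ) * I) ≠ 0 := Complex.two_pi_I_ne_zero
  have hexp : (τ ^ d)⁻¹ * Complex.exp ((Real.pi : ℂ) * I * d * z ^ 2 / τ) *
        Complex.exp (-(z / τ) * ∑ i, x i) =
      ∏ i, (τ⁻¹ * Complex.exp ((Real.pi : ℂ) * I * z ^ 2 / τ) * Complex.exp (-(z / τ) * x i)) := by
    rw [Finset.prod_mul_distrib, Finset.prod_mul_distrib, Finset.mul_sum, Complex.exp_sum]
    simp only [Finset.prod_const, Finset.card_univ, Fintype.card_fin, inv_pow,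
      ← Complex.exp_nat_mul]
    congr 3
    ring
  rw [hexp]
  unfold Efun
  rw [← Finset.prod_mul_distrib]
  refine Finset.prod_congr rfl fun i _ => ?_
  have e1 : x i / τ / (2 * (Real.pi : ℂ) * I) - z / τ = (x i / (2 * (Real.pi : ℂ) * I) - z) / τ := by
    ring
  have e2 : x i / τ / (2 * (Real.pi : ℂ) * I) = (x i / (2 * (Real.pi : ℂ) * I)) / τ := by ring
  rw [e1, e2, hmod, hmod]
  have hx := hθ i
  have hexp2 : Complex.exp (Real.pi * I * (x i / (2 * (Real.pi : ℂ) * I) - z) ^ 2 / τ) =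
      Complex.exp ((Real.pi : ℂ) * I * z ^ 2 / τ) * Complex.exp (-(z / τ) * x i) *
      Complex.exp (Real.pi * I * (x i / (2 * (Real.pi : ℂ) * I)) ^ 2 / τ) := by
    rw [← Complex.exp_add, ← Complex.exp_add]
    congr 1
    have hpi' : (Real.pi : ℂ) ≠ 0 := by exact_mod_cast Real.pi_ne_zero
    have hI := I_ne_zero
    field_simp
    ring
  rw [hexp2]
  have he := Complex.exp_ne_zero (Real.pi * I * (x i / (2 * (Real.pi : ℂ) * I)) ^ 2 / τ)
  generalize Complex.exp (Real.pi * I * (x i / (2 * (Real.pi : ℂ) * I)) ^ 2 / τ) = e at *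
  generalize jTheta (x i / (2 * (Real.pi : ℂ) * I)) τ = t at *
  generalize jTheta _ τ = u at *
  generalize Complex.exp _ = v
  generalize Complex.exp _ = w
  field_simp
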